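/- arXiv:1604.05262 — 9 statements merged into one kernel-verified Lean document; each statement's English description precedes it below -/
import Mathlib

section
/- Let $G$ be a connected finite simple graph that is claw-free and double-critical with chromatic number $6$ (i.e., for every edge $xy$ of $G$, $\chi(G - x - y) = 4$). Then $G$ is isomorphic to the complete graph $K_6$. -/
open SimpleGraph

/-- A connected graph `G` with chromatic number `n` is `n`-double-critical if
deleting the two endpoints of any edge drops the chromatic number to `n - 2`. -/
def DoubleCritical {V : Type*} (G : SimpleGraph V) (n : ℕ) : Prop :=
  G.Connected ∧ G.chromaticNumber = (n : ℕ∞) ∧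
    ∀ x y : V, G.Adj x y →
      (G.induce ({x, y}ᶜ : Set V)).chromaticNumber = ((n - 2 : ℕ) : ℕ∞)

/-- A graph is claw-free if it has no induced `K_{1,3}`. -/
def ClawFree {V : Type*} (G : SimpleGraph V) : Prop :=
  ∀ v a b c : V, G.Adj v a → G.Adj v b → G.Adj v c →
    a ≠ b → a ≠ c → b ≠ c → ¬ G.Adj a b → ¬ G.Adj a c → ¬ G.Adj b c → False

section

variable {V : Type*} {G : SimpleGraph V}

/-- `f` properly colors the graph obtained from `G` by deleting `x` and `y`. -/
def ColorsAwayFrom {α : Type*} (G : SimpleGraph V) (x y : V) (f : V → α) : Prop :=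
  ∀ u v, u ≠ x → u ≠ y → v ≠ x → v ≠ y → G.Adj u v → f u ≠ f v

theorem exists_colorsAwayFrom {n : ℕ} [NeZero n] {x y : V}
    (h : (G.induce ({x, y}ᶜ : Set V)).Colorable n) :
    ∃ f : V → Fin n, ColorsAwayFrom G x y f := by
  classical
  obtain ⟨C⟩ := h
  refine ⟨fun v => if hv : v ∈ ({x, y}ᶜ : Set V) then C ⟨v, hv⟩ else 0, ?_⟩
  intro u v hux huy hvx hvy huv
  have hu : u ∈ ({x, y}ᶜ : Set V) := by simp [hux, huy]
  have hv : v ∈ ({x, y}ᶜ : Set V) := by simp [hvx, hvy]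
  simp only [hu, hv, dite_true]
  exact C.valid (v := ⟨u, hu⟩) (w := ⟨v, hv⟩) huv

/-- If `G` is not `(n + 1)`-colorable, then every color class of an `n`-coloring of `G - x - y`
contains a common neighbor of the adjacent vertices `x` and `y`. -/
theorem ColorsAwayFrom.exists_common_neighbor {n : ℕ} (hG : ¬ G.Colorable (n + 1)) {x y : V}
    {f : V → Fin n} (hf : ColorsAwayFrom G x y f) (c : Fin n) :
    ∃ w, G.Adj x w ∧ G.Adj y w ∧ f w = c := by
  classical
  by_contra! hno
  refine hG ⟨Coloring.mk (fun v => if v = x then c.castSucc else if v = y then Fin.last n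
    else if f v = c ∧ G.Adj x v then Fin.last n else (f v).castSucc) ?_⟩
  intro u v huv
  have hne := huv.ne
  have h1 := hno u
  have h2 := hno v
  have h3 := hf u v
  have h4 := huv.symm
  have h5 := (Fin.castSucc_lt_last c).ne
  have h6 := (Fin.castSucc_lt_last (f u)).ne
  have h7 := (Fin.castSucc_lt_last (f v)).ne
  have h8 := Fin.castSucc_injective n
  have h9 := @h8 (f u) (f v)
  have h10 := @h8 (f u) c
  have h11 := @h8 c (f v)
  clear h8 hG hno hf
  split_ifs <;> grind

/-- In a double-critical graph, the neighborhood of a vertex that is not adjacent to all others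
can be colored with one color fewer than `G - x - y`. -/
theorem exists_coloring_neighbors_avoiding {n : ℕ} (hG : ¬ G.Colorable (n + 1))
    (hdc : ∀ y z, G.Adj y z → ∃ f : V → Fin n, ColorsAwayFrom G y z f)
    {x z : V} (hxz : x ≠ z) (hnadj : ¬ G.Adj x z) (hz : ∃ y, G.Adj z y) :
    ∃ (g : V → Fin n) (c : Fin n), (∀ v, G.Adj x v → g v ≠ c) ∧
      ∀ u v, G.Adj x u → G.Adj x v → G.Adj u v → g u ≠ g v := by
  classical
  by_cases hedge : ∃ y z, x ≠ y ∧ x ≠ z ∧ ¬ G.Adj x y ∧ ¬ G.Adj x z ∧ G.Adj y z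
  · obtain ⟨y, z, hxy, hxz, hy, hz, hyz⟩ := hedge
    obtain ⟨g, hg⟩ := hdc y z hyz
    refine ⟨g, g x, fun v hv => ?_, fun u v hu hv huv => ?_⟩
    · refine (hg x v hxy hxz ?_ ?_ hv).symm <;> rintro rfl <;> contradiction
    · refine hg u v ?_ ?_ ?_ ?_ huv <;> rintro rfl <;> contradiction
  · exfalso
    push Not at hedge
    obtain ⟨y, hzy⟩ := hz
    have hxy : G.Adj x y := by
      by_contra hxy
      refine hedge z y hxz ?_ hnadj hxy hzy
      rintro rfl
      exact hnadj hzy.symm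
    obtain ⟨f, hf⟩ := hdc y z hzy.symm
    refine hG ⟨Coloring.mk (fun v => if v = y then Fin.last n
      else if G.Adj x v then (f v).castSucc else (f x).castSucc) ?_⟩
    intro u v huv
    have h1 := hedge u v
    have h2 := hf u v
    have h3 := hf x u
    have h4 := hf x v
    have h5 := (Fin.castSucc_lt_last (f x)).ne
    have h6 := (Fin.castSucc_lt_last (f u)).ne
    have h7 := (Fin.castSucc_lt_last (f v)).ne
    have h8 := Fin.castSucc_injective n
    have h9 := @h8 (f u) (f v)
    have h10 := @h8 (f u) (f x)
    have h11 := @h8 (f x) (f v)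
    have h12 := hxy.ne
    have h13 := huv.ne
    have h14 := huv.symm
    clear h8 hG hdc hedge hf
    split_ifs <;> grind +splitImp

/-- In a claw-free graph, each color class in the neighborhood of a vertex has at most two
elements. -/
theorem ClawFree.card_neighbor_color_le_two [Fintype V] [DecidableEq V] [DecidableRel G.Adj]
    {α : Type*} [DecidableEq α] (hcf : ClawFree G) {x : V} {g : V → α}
    (hg : ∀ u v, G.Adj x u → G.Adj x v → G.Adj u v → g u ≠ g v) (a : α) :
    (Finset.univ.filter fun v => G.Adj x v ∧ g v = a).card ≤ 2 := by
  by_contra! h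
  obtain ⟨u, v, w, hu, hv, hw, huv, huw, hvw⟩ := Finset.two_lt_card_iff.mp h
  simp only [Finset.mem_filter, Finset.mem_univ, true_and] at hu hv hw
  exact hcf x u v w hu.1 hv.1 hw.1 huv huw hvw
    (fun h => hg u v hu.1 hv.1 h (hu.2.trans hv.2.symm))
    (fun h => hg u w hu.1 hw.1 h (hu.2.trans hw.2.symm))
    (fun h => hg v w hv.1 hw.1 h (hv.2.trans hw.2.symm))

theorem eq_top_of_clawFree_of_doubleCritical_six [Fintype V] (hconn : G.Connected)
    (hG : ¬ G.Colorable 5)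
    (hdc : ∀ y z, G.Adj y z → ∃ f : V → Fin 4, ColorsAwayFrom G y z f)
    (hcf : ClawFree G) : G = ⊤ := by
  classical
  by_contra htop
  obtain ⟨x, z, hxz, hnadj⟩ := ne_top_iff_exists_not_adj.mp htop
  have : Nontrivial V := ⟨x, z, hxz⟩
  have hnbr : ∀ v, ∃ w, G.Adj v w := hconn.preconnected.exists_adj_of_nontrivial
  obtain ⟨g, c, hgc, hg⟩ := exists_coloring_neighbors_avoiding hG hdc hxz hnadj (hnbr z)
  let A (a : Fin 4) : Finset V := Finset.univ.filter fun v => G.Adj x v ∧ g v = a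
  have hA : ∀ a, (A a).card ≤ 2 := fun a => hcf.card_neighbor_color_le_two hg a
  have key : ∀ y a, G.Adj x y → a ≠ c → a ≠ g y →
      (A a).card = 2 ∧ ∀ v, G.Adj x v → g v = a → G.Adj y v := by
    intro y a hxy hac hay
    obtain ⟨f, hf⟩ := hdc x y hxy
    let T : Finset V := Finset.univ.filter fun v => G.Adj x v ∧ G.Adj y v
    have hT : 4 ≤ T.card := by
      have himg : T.image f = Finset.univ := by
        refine Finset.eq_univ_of_forall fun i => ?_
        obtain ⟨w, hxw, hyw, hw⟩ := hf.exists_common_neighbor hG i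
        exact Finset.mem_image.mpr ⟨w, by simp [T, hxw, hyw], hw⟩
      simpa [himg] using Finset.card_image_le (s := T) (f := f)
    obtain ⟨b, hb⟩ : ∃ b, ∀ d, d ≠ c → d ≠ g y → d ≠ a → d = b := by
      have : ∀ c e a : Fin 4, a ≠ c → a ≠ e → e ≠ c →
          ∃ b, ∀ d, d ≠ c → d ≠ e → d ≠ a → d = b := by decide
      exact this c (g y) a hac hay (hgc y hxy)
    have hsub : T ⊆ A a ∪ A b := by
      intro v hv
      obtain ⟨hxv, hyv⟩ : G.Adj x v ∧ G.Adj y v := by simpa [T] using hv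
      by_cases hva : g v = a
      · simp [A, hxv, hva]
      · simp [A, hxv, hb (g v) (hgc v hxv) (hg y v hxy hxv hyv).symm hva]
    have h1 := Finset.card_le_card hsub
    have h2 := Finset.card_union_le (A a) (A b)
    have h3 := hA a
    have h4 := hA b
    have heq : T = A a ∪ A b := Finset.eq_of_subset_of_card_le hsub (by omega)
    refine ⟨by omega, fun v hxv hva => ?_⟩
    have hv : v ∈ T := by simp [heq, A, hxv, hva]
    simp only [T, Finset.mem_filter] at hv
    exact hv.2.2
  obtain ⟨y, hxy⟩ := hnbr x
  obtain ⟨f, hf⟩ := hdc x y hxy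
  obtain ⟨w, hxw, hyw, -⟩ := hf.exists_common_neighbor hG 0
  have hcard := (key w (g y) hxw (hgc y hxy) (hg y w hxy hxw hyw)).1
  obtain ⟨y', hy', hne⟩ := Finset.exists_mem_ne (by omega : 1 < (A (g y)).card) y
  obtain ⟨hxy', hgy'⟩ : G.Adj x y' ∧ g y' = g y := by simpa [A] using hy'
  obtain ⟨u, hxu, hyu, hu⟩ := hf.exists_common_neighbor hG (f y')
  have hgu : g u ≠ g y' := hgy' ▸ (hg y u hxy hxu hyu).symm
  have hadj := (key y' (g u) hxy' (hgc u hxu) hgu).2 u hxu rfl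
  exact hf y' u hxy'.ne' hne hxu.ne' hyu.ne' hadj hu.symm

end

/-- A connected, claw-free, double-critical graph of chromatic number 6
is isomorphic to $K_6$. -/
theorem stmt_0 {V : Type*} [Fintype V] (G : SimpleGraph V)
    (hconn : G.Connected) (hchi : G.chromaticNumber = (6 : ℕ∞))
    (hdc : ∀ x y : V, G.Adj x y →
      (G.induce ({x, y}ᶜ : Set V)).chromaticNumber = (4 : ℕ∞))
    (hcf : ClawFree G) :
    Nonempty (G ≃g (⊤ : SimpleGraph (Fin 6))) := by
  have hG : ¬ G.Colorable 5 := fun h => by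
    have := h.chromaticNumber_le
    rw [hchi] at this
    exact absurd this (by decide)
  obtain rfl := eq_top_of_clawFree_of_doubleCritical_six hconn hG
    (fun y z h => exists_colorsAwayFrom (chromaticNumber_le_iff_colorable.mp (hdc y z h).le)) hcf
  rw [chromaticNumber_top] at hchi
  exact ⟨Iso.completeGraph (Fintype.equivFinOfCardEq (by exact_mod_cast hchi))⟩
end

section
/- Let $G$ be an $n$-double-critical graph. If the clique number of $G$ satisfies $\omega(G) \ge n-1$, then $G$ is isomorphic to the complete graph $K_n$. -/
open SimpleGraph

/-- A clique disjoint from an edge of a double-critical graph is small. -/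
theorem DoubleCritical.card_le_of_isClique {V : Type*} {G : SimpleGraph V} {n : ℕ}
    (hdc : DoubleCritical G n) {s : Finset V} (hs : G.IsClique s) {x y : V}
    (hxy : G.Adj x y) (hx : x ∉ s) (hy : y ∉ s) : s.card ≤ n - 2 := by
  obtain ⟨C⟩ := chromaticNumber_le_iff_colorable.1 (hdc.2.2 x y hxy).le
  have hmem : ∀ v : s, (v : V) ∈ ({x, y}ᶜ : Set V) := by
    rintro ⟨v, hv⟩ (rfl | rfl)
    · exact hx hv
    · exact hy hv
  have hinj : Function.Injective fun v : s => C ⟨v, hmem v⟩ := by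
    intro u v huv
    by_contra hne
    exact C.valid (v := ⟨u, hmem u⟩) (w := ⟨v, hmem v⟩)
      (hs u.2 v.2 fun h => hne (Subtype.ext h)) huv
  simpa using Fintype.card_le_of_injective _ hinj

theorem DoubleCritical.one_le {V : Type*} {G : SimpleGraph V} {n : ℕ}
    (hdc : DoubleCritical G n) : 1 ≤ n := by
  obtain ⟨C⟩ := chromaticNumber_le_iff_colorable.1 hdc.2.1.le
  obtain ⟨v⟩ := hdc.1.nonempty
  have := (C v).2
  omega

theorem DoubleCritical.two_le_of_adj {V : Type*} {G : SimpleGraph V} {n : ℕ}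
    (hdc : DoubleCritical G n) {x y : V} (hxy : G.Adj x y) : 2 ≤ n := by
  obtain ⟨C⟩ := chromaticNumber_le_iff_colorable.1 hdc.2.1.le
  have h := C.valid hxy
  have hx := (C x).2
  have hy := (C y).2
  rw [ne_eq, Fin.ext_iff] at h
  omega

/-- A double-critical graph of chromatic number `n` with an `(n - 1)`-clique has an `n`-clique. -/
theorem DoubleCritical.exists_isNClique {V : Type*} {G : SimpleGraph V} {n : ℕ}
    (hdc : DoubleCritical G n) {s : Finset V} (hs : G.IsNClique (n - 1) s) :
    ∃ t : Finset V, G.IsNClique n t := by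
  classical
  have hn := hdc.one_le
  by_contra! hno
  have hex : ∀ v, ∃ k ∈ s, ¬ G.Adj v k ∧ (v ∈ s → k = v) := by
    intro v
    by_cases hv : v ∈ s
    · exact ⟨v, hv, G.irrefl, fun _ => rfl⟩
    · by_contra! h
      have hadj : ∀ k ∈ s, G.Adj v k := fun k hk => by
        by_contra hvk
        exact hv (h k hk hvk).1
      have := hs.insert hadj
      rw [Nat.sub_add_cancel hn] at this
      exact hno _ this
  choose f hfs hfadj hfeq using hex
  let C : G.Coloring s := Coloring.mk (fun v => ⟨f v, hfs v⟩) <| by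
    intro u v huv heq
    have heq : f u = f v := congrArg Subtype.val heq
    by_cases hu : u ∈ s
    · rw [hfeq u hu] at heq
      exact hfadj v (heq ▸ huv.symm)
    by_cases hv : v ∈ s
    · rw [hfeq v hv] at heq
      exact hfadj u (heq ▸ huv)
    have h₁ := hdc.card_le_of_isClique hs.isClique huv hu hv
    have h₂ := hdc.two_le_of_adj huv
    have h₃ := hs.card_eq
    omega
  have h := C.colorable.chromaticNumber_le
  rw [hdc.2.1, Fintype.card_coe, hs.card_eq, Nat.cast_le] at h
  omega

/-- An `n`-clique in an `n`-double-critical graph contains every vertex. -/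
theorem DoubleCritical.mem_of_isNClique {V : Type*} {G : SimpleGraph V} {n : ℕ}
    (hdc : DoubleCritical G n) {t : Finset V} (ht : G.IsNClique n t) (v : V) : v ∈ t := by
  classical
  obtain ⟨q, hq⟩ : t.Nonempty := Finset.card_pos.1 (ht.card_eq ▸ hdc.one_le)
  by_contra hv
  obtain ⟨p⟩ := hdc.1.preconnected q v
  obtain ⟨d, -, hd₁, hd₂⟩ := p.exists_boundary_dart (t : Set V) hq hv
  have h₁ := hdc.card_le_of_isClique (s := t.erase d.fst)
    (ht.isClique.subset (by simp)) d.adj (by simp)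
    (fun h => hd₂ (Finset.mem_of_mem_erase h))
  rw [Finset.card_erase_of_mem hd₁, ht.card_eq] at h₁
  have h₂ := hdc.two_le_of_adj d.adj
  omega

/-- If an $n$-double-critical graph has clique number at least $n-1$,
then it is isomorphic to $K_n$. -/
theorem stmt_1 {V : Type*} [Fintype V] (G : SimpleGraph V) (n : ℕ)
    (hdc : DoubleCritical G n) (hω : n - 1 ≤ G.cliqueNum) :
    Nonempty (G ≃g (⊤ : SimpleGraph (Fin n))) := by
  obtain ⟨m, hm⟩ := G.exists_isNClique_cliqueNum
  obtain ⟨s, hsm, hs⟩ := Finset.exists_subset_card_eq (hm.card_eq.symm ▸ hω)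
  obtain ⟨t, ht⟩ := hdc.exists_isNClique ⟨hm.isClique.subset hsm, hs⟩
  have hmem := hdc.mem_of_isNClique ht
  have hcard : Fintype.card V = n := by
    rw [← Finset.card_univ, ← Finset.eq_univ_of_forall hmem, ht.card_eq]
  refine ⟨⟨Fintype.equivFinOfCardEq hcard, ?_⟩⟩
  intro a b
  rw [top_adj, (Equiv.injective _).ne_iff]
  exact ⟨fun h => ht.isClique (hmem a) (hmem b) h, fun h => h.ne⟩
end

section
/- Let $G$ be an $n$-double-critical graph. If $G$ is not isomorphic to the complete graph $K_n$, then the clique number of $G$ satisfies $\omega(G) \le n-2$. -/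
open SimpleGraph

/-- A clique inside the vertex set of an induced subgraph is no larger than any number of colors
that suffices to color that subgraph. -/
theorem SimpleGraph.IsClique.card_le_of_induce_colorable {V : Type*} {G : SimpleGraph V}
    {S : Set V} {t : Finset V} {m : ℕ} (ht : G.IsClique (t : Set V)) (htS : (t : Set V) ⊆ S)
    (hS : (G.induce S).Colorable m) : t.card ≤ m := by
  obtain ⟨C⟩ := hS
  have hinj : Function.Injective (fun v : t => C ⟨v, htS v.2⟩) := by
    intro v w hvw
    by_contra hne
    exact C.valid (v := ⟨v, htS v.2⟩) (w := ⟨w, htS w.2⟩)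
      (ht v.2 w.2 fun h => hne (Subtype.ext h)) hvw
  simpa using Fintype.card_le_of_injective _ hinj

namespace DoubleCritical

variable {V : Type*} {G : SimpleGraph V} {n : ℕ}

theorem two_le_of_adj_s2 (h : DoubleCritical G n) {x y : V} (hxy : G.Adj x y) : 2 ≤ n := by
  have := two_le_chromaticNumber_of_adj hxy
  rw [h.2.1] at this
  exact_mod_cast this

theorem card_le_of_disjoint_edge (h : DoubleCritical G n) {x y : V} (hxy : G.Adj x y)
    {t : Finset V} (ht : G.IsClique (t : Set V)) (hx : x ∉ t) (hy : y ∉ t) :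
    t.card ≤ n - 2 := by
  refine ht.card_le_of_induce_colorable (S := {x, y}ᶜ) ?_
    (chromaticNumber_le_iff_colorable.mp (h.2.2 x y hxy).le)
  rintro v hv (rfl | rfl)
  exacts [hx hv, hy hv]

theorem eq_univ_of_isNClique [Fintype V] (h : DoubleCritical G n) {s : Finset V}
    (hs : G.IsNClique n s) (hne : s.Nonempty) : s = Finset.univ := by
  classical
  by_contra hsu
  obtain ⟨z, hz⟩ : ∃ z, z ∉ s := by simpa [Finset.eq_univ_iff_forall] using hsu
  obtain ⟨x, hx⟩ := hne
  obtain ⟨p⟩ := h.1.preconnected x z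
  obtain ⟨d, -, hd, hd'⟩ := p.exists_boundary_dart (s : Set V) hx hz
  have h2 := h.two_le_of_adj_s2 d.adj
  have hcard := h.card_le_of_disjoint_edge d.adj (t := s.erase d.fst)
    (hs.isClique.subset (by simp)) (by simp) (fun hm => hd' (Finset.mem_of_mem_erase hm))
  rw [Finset.card_erase_of_mem hd, hs.card_eq] at hcard
  omega

theorem exists_isNClique_s2 (h : DoubleCritical G n) (hn : 2 ≤ n) {s : Finset V}
    (hs : G.IsNClique (n - 1) s) : ∃ t, G.IsNClique n t := by
  classical
  by_contra! hno
  have hnonadj : ∀ v, v ∉ s → ∃ w ∈ s, ¬ G.Adj v w := by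
    intro v hv
    by_contra! hall
    have := hs.insert hall
    rw [Nat.sub_add_cancel (by omega)] at this
    exact hno _ this
  choose! f hfs hf using hnonadj
  let C : G.Coloring s := Coloring.mk
    (fun v => if hv : v ∈ s then ⟨v, hv⟩ else ⟨f v, hfs v hv⟩) (by
      intro v w hvw heq
      by_cases hv : v ∈ s <;> by_cases hw : w ∈ s <;>
        simp only [hv, hw, dite_true, dite_false, Subtype.mk.injEq] at heq
      · exact hvw.ne heq
      · exact hf w hw (heq ▸ hvw.symm)
      · exact hf v hv (heq ▸ hvw)
      · have := h.card_le_of_disjoint_edge hvw hs.isClique hv hw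
        rw [hs.card_eq] at this
        omega)
  have hle := C.colorable.chromaticNumber_le
  rw [h.2.1, Fintype.card_coe, hs.card_eq] at hle
  have : n ≤ n - 1 := by exact_mod_cast hle
  omega

theorem nonempty_iso_top [Fintype V] (h : DoubleCritical G n) {s : Finset V}
    (hs : G.IsNClique n s) (hne : s.Nonempty) : Nonempty (G ≃g (⊤ : SimpleGraph (Fin n))) := by
  have hu := h.eq_univ_of_isNClique hs hne
  subst hu
  have htop : G = ⊤ := by simpa using hs.isClique
  subst htop
  exact ⟨Iso.completeGraph (Fintype.equivFinOfCardEq hs.card_eq)⟩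

end DoubleCritical

/-- If an $n$-double-critical graph is not isomorphic to $K_n$,
then its clique number is at most $n-2$. -/
theorem stmt_2 {V : Type*} [Fintype V] (G : SimpleGraph V) (n : ℕ)
    (hdc : DoubleCritical G n)
    (hniso : ¬ Nonempty (G ≃g (⊤ : SimpleGraph (Fin n)))) :
    G.cliqueNum ≤ n - 2 := by
  by_contra! hlt
  obtain ⟨s, hs⟩ := G.exists_isNClique_cliqueNum
  have hle : G.cliqueNum ≤ n := by
    have := hs.isClique.card_le_chromaticNumber
    rw [hdc.2.1, hs.card_eq] at this
    exact_mod_cast this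
  obtain ⟨t, ht⟩ : ∃ t, G.IsNClique n t := by
    rcases hle.eq_or_lt with heq | hlt'
    · exact ⟨s, heq ▸ hs⟩
    · have heq : G.cliqueNum = n - 1 := by omega
      exact hdc.exists_isNClique_s2 (by omega) (heq ▸ hs)
  refine hniso (hdc.nonempty_iso_top ht ?_)
  rw [← Finset.card_pos, ht.card_eq]
  omega
end

section
/- Let $G$ be an $n$-double-critical graph that is claw-free. Let $xy \in E(G)$ and let $V_1, \ldots, V_{n-2}$ be the color classes of a proper $(n-2)$-coloring of $G - x - y$. Then for every $i \in \{1, \ldots, n-2\}$, the set $N(x) \cap N(y) \cap V_i$ is nonempty. -/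
open SimpleGraph

/-- If some color class `i` of a coloring of `G - x - y` has no common neighbor of `x` and `y`,
then `G` can be colored with only one additional color. -/
theorem colorable_option_of_no_common_neighbor {V α : Type*} (G : SimpleGraph V) (x y : V)
    (C : (G.induce ({x, y}ᶜ : Set V)).Coloring α) (i : α)
    (h : ∀ v : ({x, y}ᶜ : Set V), G.Adj x ↑v → G.Adj y ↑v → C v ≠ i) :
    Nonempty (G.Coloring (Option α)) := by
  classical
  let f : V → Option α := fun v =>
    if hv : v ∈ ({x, y}ᶜ : Set V) then
      if C ⟨v, hv⟩ = i ∧ G.Adj x v then none else some (C ⟨v, hv⟩)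
    else if v = x then some i else none
  have valid : ∀ u v : V, G.Adj u v → f u ≠ f v := by
    intro u v huv
    have hne := huv.ne
    have hvu := huv.symm
    by_cases hu : u ∈ ({x, y}ᶜ : Set V) <;> by_cases hv : v ∈ ({x, y}ᶜ : Set V)
    · have hC : C ⟨u, hu⟩ ≠ C ⟨v, hv⟩ := C.valid (by simpa using huv)
      simp only [f, dif_pos hu, dif_pos hv]
      grind
    · have hC := h ⟨u, hu⟩
      simp only [f, dif_pos hu, dif_neg hv]
      simp only [Set.mem_compl_iff, Set.mem_insert_iff, Set.mem_singleton_iff, not_not] at hv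
      grind
    · have hC := h ⟨v, hv⟩
      simp only [f, dif_neg hu, dif_pos hv]
      simp only [Set.mem_compl_iff, Set.mem_insert_iff, Set.mem_singleton_iff, not_not] at hu
      grind
    · simp only [f, dif_neg hu, dif_neg hv]
      simp only [Set.mem_compl_iff, Set.mem_insert_iff, Set.mem_singleton_iff, not_not] at hu hv
      grind
  exact ⟨Coloring.mk f fun {u v} huv => valid u v huv⟩

/-- In a claw-free $n$-double-critical graph, for any edge $xy$ and any proper
$(n-2)$-coloring of $G-x-y$, every color class meets $N(x) \cap N(y)$. -/
theorem stmt_3 {V : Type*} [Fintype V] (G : SimpleGraph V) (n : ℕ)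
    (hdc : DoubleCritical G n) (hcf : ClawFree G)
    (x y : V) (hxy : G.Adj x y)
    (C : (G.induce ({x, y}ᶜ : Set V)).Coloring (Fin (n - 2))) :
    ∀ i : Fin (n - 2), ∃ v : ({x, y}ᶜ : Set V),
      G.Adj x ↑v ∧ G.Adj y ↑v ∧ C v = i := by
  intro i
  by_contra! hno
  obtain ⟨D⟩ := colorable_option_of_no_common_neighbor G x y C i hno
  have hle := D.colorable.chromaticNumber_le
  rw [hdc.2.1, Nat.cast_le, Fintype.card_option, Fintype.card_fin] at hle
  have := i.isLt
  omega
end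

section
/- Let $G$ be an $n$-double-critical graph that is claw-free. Then for every edge $xy \in E(G)$, the number of common neighbors of $x$ and $y$ satisfies $|N(x) \cap N(y)| \ge n-2$. -/
open SimpleGraph

/-- If a color class of a coloring of `G - x - y` contains no common neighbor of `x` and `y`,
then `G` can be colored with one additional color. -/
theorem colorable_succ_of_no_common_neighbor {V : Type*} {G : SimpleGraph V} {x y : V}
    {m : ℕ} (C : (G.induce ({x, y}ᶜ : Set V)).Coloring (Fin m)) (i : Fin m)
    (h : ∀ v, C v = i → G.Adj x v → ¬ G.Adj y v) : G.Colorable (m + 1) := by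
  classical
  have mem : ∀ v, v ≠ x → v ≠ y → v ∈ ({x, y}ᶜ : Set V) := by
    intro v hx hy
    simp [hx, hy]
  let f : V → Option (Fin m) := fun v =>
    if hx : v = x then some i
    else if hy : v = y then none
    else if C ⟨v, mem v hx hy⟩ = i ∧ G.Adj x v then none
    else some (C ⟨v, mem v hx hy⟩)
  have valid : ∀ u v, G.Adj u v → f u ≠ f v := by
    intro u v huv
    have hC : ∀ hu hv, C ⟨u, hu⟩ ≠ C ⟨v, hv⟩ := fun hu hv =>
      C.valid (v := ⟨u, hu⟩) (w := ⟨v, hv⟩) huv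
    have hne := huv.ne
    have hvu := huv.symm
    simp only [f]
    grind
  simpa using (Coloring.mk f (fun {u v} huv => valid u v huv)).colorable

/-- If `G - x - y` is `m`-colorable but `G` is not `(m + 1)`-colorable, then `x` and `y` have at
least `m` common neighbors: one in each color class. -/
theorem le_ncard_common_neighbors {V : Type*} [Finite V] {G : SimpleGraph V} {x y : V}
    {m : ℕ} (hC : (G.induce ({x, y}ᶜ : Set V)).Colorable m)
    (hG : ¬ G.Colorable (m + 1)) : m ≤ (G.neighborSet x ∩ G.neighborSet y).ncard := by
  obtain ⟨C⟩ := hC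
  have hex : ∀ i, ∃ v, C v = i ∧ G.Adj x v ∧ G.Adj y v := by
    intro i
    by_contra! h
    exact hG (colorable_succ_of_no_common_neighbor C i h)
  choose v hv hvx hvy using hex
  have hinj : Function.Injective fun i => (v i : V) := by
    intro i j hij
    rw [← hv i, ← hv j, Subtype.ext hij]
  calc
    m = (Set.range fun i => (v i : V)).ncard := by
      rw [← Nat.card_coe_set_eq, Nat.card_range_of_injective hinj, Nat.card_fin]
    _ ≤ _ := by
      refine Set.ncard_le_ncard ?_ (Set.toFinite _)
      rintro _ ⟨i, rfl⟩
      exact ⟨hvx i, hvy i⟩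

/-- In a claw-free $n$-double-critical graph, any two adjacent vertices have
at least $n-2$ common neighbors. -/
theorem stmt_4 {V : Type*} [Fintype V] (G : SimpleGraph V) (n : ℕ)
    (hdc : DoubleCritical G n) (hcf : ClawFree G) :
    ∀ x y : V, G.Adj x y →
      n - 2 ≤ (G.neighborSet x ∩ G.neighborSet y).ncard := by
  intro x y hxy
  obtain ⟨-, hn, hdel⟩ := hdc
  rcases Nat.lt_or_ge n 2 with h2 | h2
  · omega
  · refine le_ncard_common_neighbors
      (chromaticNumber_le_iff_colorable.1 (hdel x y hxy).le) fun h => ?_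
    have hle := chromaticNumber_le_iff_colorable.2 h
    rw [hn, Nat.cast_le] at hle
    omega
end

section
/- Let $G$ be a $6$-double-critical graph that is claw-free. If there exists an edge $xy \in E(G)$ with $|N(x) \cap N(y)| = 4$, then $G$ is isomorphic to the complete graph $K_6$. -/
open SimpleGraph

namespace DoubleCritical

open Finset

variable {V : Type*} {G : SimpleGraph V}

/-- Deleting both ends of an edge leaves a `4`-colourable graph. -/
theorem exists_coloring (hdc : DoubleCritical G 6) {x y : V} (hxy : G.Adj x y) :
    ∃ f : V → Fin 4, ∀ u v, u ≠ x → u ≠ y → v ≠ x → v ≠ y → G.Adj u v → f u ≠ f v := by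
  classical
  have h4 := hdc.2.2 x y hxy
  have hcol : (G.induce ({x, y}ᶜ : Set V)).Colorable 4 :=
    chromaticNumber_le_iff_colorable.1 (by rw [h4])
  obtain ⟨c⟩ := hcol
  refine ⟨fun v => if h : v ∈ ({x, y}ᶜ : Set V) then c ⟨v, h⟩ else 0, ?_⟩
  intro u v hux huy hvx hvy huv
  have hu : u ∈ ({x, y}ᶜ : Set V) := by simp [hux, huy]
  have hv : v ∈ ({x, y}ᶜ : Set V) := by simp [hvx, hvy]
  simp only [hu, hv, dif_pos]
  exact c.valid (by simpa using huv)

theorem not_colorable_five (hdc : DoubleCritical G 6) : ¬ G.Colorable 5 := by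
  intro h
  have h6 := hdc.2.1 ▸ chromaticNumber_le_iff_colorable.2 h
  exact absurd h6 (by norm_num)

theorem not_coloring (hdc : DoubleCritical G 6) {α : Type*} [Fintype α]
    (hα : Fintype.card α = 5) (g : V → α) : ∃ u v, G.Adj u v ∧ g u = g v := by
  by_contra! hg
  have h := (Coloring.mk (G := G) g (fun {u v} huv => hg u v huv)).colorable
  rw [hα] at h
  exact hdc.not_colorable_five h

/-- Every colour class of `G - x - y` contains a common neighbour of `x` and `y`. -/
theorem exists_common (hdc : DoubleCritical G 6) {x y : V} {f : V → Fin 4}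
    (hf : ∀ u v, u ≠ x → u ≠ y → v ≠ x → v ≠ y → G.Adj u v → f u ≠ f v) (i : Fin 4) :
    ∃ w, G.Adj x w ∧ G.Adj y w ∧ f w = i := by
  classical
  by_contra! hno
  obtain ⟨u, v, huv, hg⟩ := hdc.not_coloring (α := Option (Fin 4)) (by simp)
    (fun w => if w = x then some i else if w = y then none else
      if f w = i ∧ G.Adj x w then none else some (f w))
  have hne := huv.ne
  have hvu := huv.symm
  have key := hf u v
  have k1 := hno u
  have k2 := hno v
  grind

/-- For distinct colours `i`, `j` there is a path from `x` to `y` whose inner vertices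
have colours `i` and `j`, in this order. -/
theorem exists_path (hdc : DoubleCritical G 6) {x y : V} {f : V → Fin 4}
    (hf : ∀ u v, u ≠ x → u ≠ y → v ≠ x → v ≠ y → G.Adj u v → f u ≠ f v) {i j : Fin 4}
    (hij : i ≠ j) :
    ∃ u w, u ≠ y ∧ w ≠ x ∧ G.Adj x u ∧ G.Adj u w ∧ G.Adj y w ∧ f u = i ∧ f w = j := by
  classical
  by_contra! hno
  obtain ⟨P, hP⟩ : ∃ P : V → Prop, ∀ w, P w ↔ ∃ u, u ≠ y ∧ G.Adj x u ∧ G.Adj u w ∧ f u = i :=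
    ⟨_, fun _ => Iff.rfl⟩
  obtain ⟨u, v, huv, hg⟩ := hdc.not_coloring (α := Option (Fin 4)) (by simp)
    (fun w => if w = x then some i else if w = y then none else
      if f w = i ∧ G.Adj x w then some j else if f w = j ∧ P w then none else some (f w))
  have hne := huv.ne
  have hvu := huv.symm
  have key := hf u v
  have hPu := hP u
  have hPv := hP v
  grind

/-- A clique avoiding both ends of an edge has at most four vertices. -/
theorem card_clique_le (hdc : DoubleCritical G 6) {x y : V} (hxy : G.Adj x y) {s : Finset V}
    (hs : G.IsClique (s : Set V)) (hx : x ∉ s) (hy : y ∉ s) : s.card ≤ 4 := by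
  obtain ⟨f, hf⟩ := hdc.exists_coloring hxy
  have h : s.card ≤ (univ : Finset (Fin 4)).card := by
    refine card_le_card_of_injOn f (by simp) ?_
    intro u hu v hv huv
    by_contra hne
    exact hf u v (by rintro rfl; exact hx hu) (by rintro rfl; exact hy hu)
      (by rintro rfl; exact hx hv) (by rintro rfl; exact hy hv) (hs hu hv hne) huv
  simpa using h

theorem exists_adj (hdc : DoubleCritical G 6) (v : V) : ∃ w, G.Adj v w := by
  by_contra! hno
  obtain ⟨a, b, hab, -⟩ := hdc.not_coloring (α := Fin 5) (by simp) (fun _ => 0)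
  have : Nontrivial V := ⟨a, b, hab.ne⟩
  obtain ⟨w, hw⟩ := hdc.1.preconnected.exists_adj_of_nontrivial v
  exact hno w hw

theorem nonempty_iso_of_clique_six (hdc : DoubleCritical G 6) [Fintype V] {s : Finset V}
    (hs : G.IsClique (s : Set V)) (h6 : s.card = 6) :
    Nonempty (G ≃g (⊤ : SimpleGraph (Fin 6))) := by
  classical
  have hall : ∀ v, v ∈ s := by
    by_contra! hex
    obtain ⟨v, hv⟩ := hex
    obtain ⟨w, hw⟩ := hdc.exists_adj v
    have h := hdc.card_clique_le (s := s.erase w) hw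
      (hs.subset (by simp)) (by simp [hv]) (by simp)
    have := pred_card_le_card_erase (s := s) (a := w)
    omega
  have hs' : s = univ := by ext v; simp [hall v]
  have hc : Fintype.card V = 6 := by rw [← h6, hs']; rfl
  refine ⟨⟨Fintype.equivFinOfCardEq hc, ?_⟩⟩
  intro a b
  simp only [top_adj, ne_eq, EmbeddingLike.apply_eq_iff_eq]
  exact ⟨fun h => hs (hall a) (hall b) h, fun h => h.ne⟩

/-- A `6`-double-critical graph containing `K₅` is `K₆`. -/
theorem nonempty_iso_of_clique_five (hdc : DoubleCritical G 6) [Fintype V] {s : Finset V}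
    (hs : G.IsClique (s : Set V)) (h5 : s.card = 5) :
    Nonempty (G ≃g (⊤ : SimpleGraph (Fin 6))) := by
  classical
  by_cases hv : ∃ v, v ∉ s ∧ ∀ u ∈ s, G.Adj v u
  · obtain ⟨v, hvs, hv⟩ := hv
    refine hdc.nonempty_iso_of_clique_six (s := insert v s) ?_ (by simp [hvs, h5])
    rw [coe_insert]
    exact hs.insert fun u hu _ => hv u hu
  · push Not at hv
    have hv' : ∀ v, ∃ u : s, (v ∈ s → v = u) ∧ (v ∉ s → ¬ G.Adj v u) := by
      intro v
      by_cases hvs : v ∈ s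
      · exact ⟨⟨v, hvs⟩, by simp [hvs]⟩
      · obtain ⟨u, hu, hvu⟩ := hv v hvs
        exact ⟨⟨u, hu⟩, by simp [hvs, hvu]⟩
    choose g hg using hv'
    obtain ⟨u, v, huv, hguv⟩ := hdc.not_coloring (by simp [h5]) g
    by_cases hu : u ∈ s
    · by_cases hv : v ∈ s
      · exact (huv.ne (((hg u).1 hu).trans (by rw [hguv, ← (hg v).1 hv]))).elim
      · have := (hg v).2 hv
        rw [← hguv, ← (hg u).1 hu] at this
        exact (this huv.symm).elim
    · by_cases hv : v ∈ s
      · have := (hg u).2 hu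
        rw [hguv, ← (hg v).1 hv] at this
        exact (this huv).elim
      · have := hdc.card_clique_le huv hs hu hv
        omega

/-- In a claw-free graph, two neighbours of `x` that are not adjacent to a third neighbour
`y` are adjacent. -/
theorem _root_.ClawFree.adj (hcf : ClawFree G) {x y a b : V} (hy : G.Adj x y) (ha : G.Adj x a)
    (hb : G.Adj x b) (hya : ¬ G.Adj y a) (hyb : ¬ G.Adj y b) (h1 : y ≠ a) (h2 : y ≠ b)
    (hab : a ≠ b) : G.Adj a b := by
  by_contra h
  exact hcf x y a b hy ha hb h1 h2 hab hya hyb h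

/-- The neighbours of `x` distinct from `y` and not adjacent to `y` do not form a singleton. -/
theorem exists_second_private (hdc : DoubleCritical G 6) {x y a : V} (hxy : G.Adj x y)
    (ha : G.Adj x a) (hay : a ≠ y) (hya : ¬ G.Adj y a) :
    ∃ b, b ≠ a ∧ G.Adj x b ∧ b ≠ y ∧ ¬ G.Adj y b := by
  obtain ⟨f, hf⟩ := hdc.exists_coloring ha
  obtain ⟨w, hxw, haw, hw⟩ := hdc.exists_common hf (f y)
  refine ⟨w, haw.ne', hxw, ?_, ?_⟩
  · rintro rfl
    exact hya haw.symm
  · intro hyw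
    exact hf y w hxy.ne' hay.symm hxw.ne' haw.ne' hyw hw.symm

open Classical in
theorem four_le_card_common (hdc : DoubleCritical G 6) [Fintype V] {x y : V} (hxy : G.Adj x y) :
    4 ≤ #{w | G.Adj x w ∧ G.Adj y w} := by
  obtain ⟨f, hf⟩ := hdc.exists_coloring hxy
  choose c hxc hyc hfc using hdc.exists_common hf
  have hinj : Function.Injective c := fun i j h => by rw [← hfc i, ← hfc j, h]
  have h : (univ.image c).card = 4 := by simp [card_image_of_injective _ hinj]
  rw [← h]
  refine card_le_card fun w hw => ?_
  obtain ⟨i, -, rfl⟩ := mem_image.1 hw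
  simp [hxc, hyc]

open Classical in
theorem _root_.SimpleGraph.degree_eq_card_common_add [Fintype V] {x y : V} (hxy : G.Adj x y) :
    G.degree x = #{w | G.Adj x w ∧ G.Adj y w} + #{w | G.Adj x w ∧ w ≠ y ∧ ¬ G.Adj y w} + 1 := by
  have h1 : G.neighborFinset x = ({w | G.Adj x w ∧ G.Adj y w} : Finset V) ∪
      ({w | G.Adj x w ∧ w ≠ y ∧ ¬ G.Adj y w} : Finset V) ∪ {y} := by
    ext w
    have := G.irrefl (v := y)
    simp only [mem_neighborFinset, mem_union, mem_filter, mem_univ, true_and, mem_singleton]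
    grind
  rw [← card_neighborFinset_eq_degree, h1, card_union_of_disjoint, card_union_of_disjoint,
    card_singleton]
  · refine disjoint_left.2 fun w hw hw' => ?_
    simp only [mem_filter, mem_univ, true_and] at hw hw'
    exact hw'.2.2 hw.2
  · simp

theorem _root_.SimpleGraph.not_adj_five (h5 : ∀ s : Finset V, G.IsClique (s : Set V) → s.card ≠ 5)
    {p q r s t : V} (hpq : G.Adj p q) (hpr : G.Adj p r) (hps : G.Adj p s) (hpt : G.Adj p t)
    (hqr : G.Adj q r) (hqs : G.Adj q s) (hqt : G.Adj q t) (hrs : G.Adj r s) (hrt : G.Adj r t) :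
    ¬ G.Adj s t := by
  classical
  intro hst
  refine h5 {p, q, r, s, t} ?_ ?_
  · simp [isClique_insert, hpq, hpr, hps, hpt, hqr, hqs, hqt, hrs, hrt, hst]
  · simp [hpq.ne, hpr.ne, hps.ne, hpt.ne, hqr.ne, hqs.ne, hqt.ne, hrs.ne, hrt.ne, hst.ne]

/-- In a graph without `K₅` it is impossible that `x` has two neighbours not adjacent to its
neighbour `y`, every vertex in `N(x)` has at most two non-neighbours in `N(x)`, and `x` and `y`
have exactly one common neighbour of each colour. -/
theorem false_of_two_private (hdc : DoubleCritical G 6) (hcf : ClawFree G)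
    (h5 : ∀ s : Finset V, G.IsClique (s : Set V) → s.card ≠ 5) {x y a₁ a₂ : V} {f : V → Fin 4}
    (hf : ∀ u v, u ≠ x → u ≠ y → v ≠ x → v ≠ y → G.Adj u v → f u ≠ f v)
    (hxy : G.Adj x y) (hne : a₁ ≠ a₂) (hxa₁ : G.Adj x a₁) (hxa₂ : G.Adj x a₂)
    (ha₁y : a₁ ≠ y) (ha₂y : a₂ ≠ y) (hya₁ : ¬ G.Adj y a₁) (hya₂ : ¬ G.Adj y a₂)
    (hD : ∀ z p q r, G.Adj x z → G.Adj x p → p ≠ z → ¬ G.Adj z p → G.Adj x q → q ≠ z →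
      ¬ G.Adj z q → G.Adj x r → r ≠ z → ¬ G.Adj z r → p = q ∨ p = r ∨ q = r)
    (c : Fin 4 → V) (hxc : ∀ i, G.Adj x (c i)) (hyc : ∀ i, G.Adj y (c i))
    (hfc : ∀ i, f (c i) = i) (hc : ∀ w, G.Adj x w → G.Adj y w → ∃ i, w = c i) : False := by
  have hA : ∀ w, G.Adj x w → w ≠ y → ¬ G.Adj y w → w = a₁ ∨ w = a₂ := fun w h1 h2 h3 => by
    have := hD y a₁ a₂ w hxy hxa₁ ha₁y hya₁ hxa₂ ha₂y hya₂ h1 h2 h3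
    grind
  have haa : G.Adj a₁ a₂ := hcf.adj hxy hxa₁ hxa₂ hya₁ hya₂ ha₁y.symm ha₂y.symm hne
  have hfa : f a₁ ≠ f a₂ := hf _ _ hxa₁.ne' ha₁y hxa₂.ne' ha₂y haa
  have hcy : ∀ i, c i ≠ y := fun i => (hyc i).ne'
  have hcx : ∀ i, c i ≠ x := fun i => (hxc i).ne'
  have hcinj : ∀ i j, c i = c j → i = j := fun i j h => by rw [← hfc i, ← hfc j, h]
  have hac : ∀ a, ¬ G.Adj y a → ∀ i, a ≠ c i := fun a ha i h => ha (h ▸ hyc i)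
  have hsame : ∀ a, G.Adj x a → a ≠ y → ¬ G.Adj a (c (f a)) := fun a hxa hay hadj =>
    hf _ _ hxa.ne' hay (hcx _) (hcy _) hadj (hfc _).symm
  -- a private neighbour of `x` is adjacent to all common neighbours of a different colour
  have hadj : ∀ a, G.Adj x a → a ≠ y → ¬ G.Adj y a → ∀ i, i ≠ f a → G.Adj a (c i) := by
    intro a hxa hay hya i hi
    by_contra hn
    have hya' : ¬ G.Adj a y := fun h => hya h.symm
    rcases hD a y (c (f a)) (c i) hxa hxy hay.symm hya' (hxc _) (hac a hya _).symm
      (hsame a hxa hay) (hxc _) (hac a hya _).symm hn with h | h | h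
    · exact hcy _ h.symm
    · exact hcy _ h.symm
    · exact hi (hcinj _ _ h).symm
  obtain ⟨i, j, hi₁, hi₂, hj₁, hj₂, hij, hcov⟩ : ∃ i j : Fin 4, i ≠ f a₁ ∧ i ≠ f a₂ ∧
      j ≠ f a₁ ∧ j ≠ f a₂ ∧ i ≠ j ∧ ∀ k, k = f a₁ ∨ k = f a₂ ∨ k = i ∨ k = j := by
    generalize f a₁ = p at *
    generalize f a₂ = q at *
    clear hf hfc
    revert p q
    decide
  have hnij : ¬ G.Adj (c i) (c j) :=
    not_adj_five h5 hxa₁ hxa₂ (hxc i) (hxc j) haa (hadj a₁ hxa₁ ha₁y hya₁ i hi₁)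
      (hadj a₁ hxa₁ ha₁y hya₁ j hj₁) (hadj a₂ hxa₂ ha₂y hya₂ i hi₂) (hadj a₂ hxa₂ ha₂y hya₂ j hj₂)
  -- non-adjacency to a colour without private neighbours of `x` gives a private neighbour of `y`
  have hstep : ∀ i k, i ≠ f a₁ → i ≠ f a₂ → k ≠ i → ¬ G.Adj (c i) (c k) →
      ∃ b, G.Adj y b ∧ b ≠ x ∧ ¬ G.Adj x b ∧ f b = k := by
    intro i k hi₁ hi₂ hki hn
    obtain ⟨u, w, huy, hwx, hxu, huw, hyw, hfu, hfw⟩ := hdc.exists_path hf hki.symm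
    have hu : u = c i := by
      by_cases hyu : G.Adj y u
      · obtain ⟨l, rfl⟩ := hc u hxu hyu
        rw [← hfu, hfc]
      · rcases hA u hxu huy hyu with rfl | rfl
        · exact (hi₁ hfu.symm).elim
        · exact (hi₂ hfu.symm).elim
    refine ⟨w, hyw, hwx, fun hxw => ?_, hfw⟩
    obtain ⟨l, rfl⟩ := hc w hxw hyw
    rw [hfc] at hfw
    rw [hu, hfw] at huw
    exact hn huw
  have hsecond : ∀ i j, i ≠ f a₁ → i ≠ f a₂ → i ≠ j → ¬ G.Adj (c i) (c j) →
      ∃ k, k ≠ i ∧ k ≠ j ∧ ¬ G.Adj (c i) (c k) := by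
    intro i j hi₁ hi₂ hij hn
    obtain ⟨b, hbj, hxb, hbi, hib⟩ :=
      hdc.exists_second_private (hxc i) (hxc j) (fun h => hij (hcinj _ _ h).symm) hn
    have hby : b ≠ y := by
      rintro rfl
      exact hib (hyc i).symm
    by_cases hyb : G.Adj y b
    · obtain ⟨k, rfl⟩ := hc b hxb hyb
      exact ⟨k, fun h => hbi (by rw [h]), fun h => hbj (by rw [h]), hib⟩
    · rcases hA b hxb hby hyb with rfl | rfl
      · exact (hib (hadj _ hxb hby hyb i hi₁).symm).elim
      · exact (hib (hadj _ hxb hby hyb i hi₂).symm).elim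
  obtain ⟨k, hki, hkj, hik⟩ := hsecond i j hi₁ hi₂ hij hnij
  obtain ⟨l, hlj, hli, hjl⟩ := hsecond j i hj₁ hj₂ hij.symm fun h => hnij h.symm
  have hkl : k ≠ l := by
    rintro rfl
    obtain ⟨a, hxa, hay, hya, hka⟩ : ∃ a, G.Adj x a ∧ a ≠ y ∧ ¬ G.Adj y a ∧ k = f a := by
      rcases hcov k with h | h | h | h
      · exact ⟨a₁, hxa₁, ha₁y, hya₁, h⟩
      · exact ⟨a₂, hxa₂, ha₂y, hya₂, h⟩
      · exact (hki h).elim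
      · exact (hkj h).elim
    rcases hD (c k) (c i) (c j) a (hxc _) (hxc _) (fun h => hki (hcinj _ _ h).symm)
      (fun h => hik h.symm) (hxc _) (fun h => hkj (hcinj _ _ h).symm) (fun h => hjl h.symm)
      hxa (hac a hya k) (fun h => hsame a hxa hay (hka ▸ h.symm)) with h | h | h
    · exact hij (hcinj _ _ h)
    · exact hac a hya _ h.symm
    · exact hac a hya _ h.symm
  have hb : ∀ m, ∃ b, G.Adj y b ∧ b ≠ x ∧ ¬ G.Adj x b ∧ f b = m := by
    intro m
    have hm : m = i ∨ m = j ∨ m = k ∨ m = l := by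
      clear * - hij hki hkj hlj hli hkl
      omega
    rcases hm with rfl | rfl | rfl | rfl
    · exact hstep j m hj₁ hj₂ hij fun h => hnij h.symm
    · exact hstep i m hi₁ hi₂ hij.symm hnij
    · exact hstep i m hi₁ hi₂ hki hik
    · exact hstep j m hj₁ hj₂ hlj hjl
  choose b hyb hbx hxb hfb using hb
  have hbb : ∀ m n, m ≠ n → G.Adj (b m) (b n) := fun m n hmn =>
    hcf.adj hxy.symm (hyb m) (hyb n) (hxb m) (hxb n) (hbx m).symm (hbx n).symm
      fun h => hmn (by rw [← hfb m, ← hfb n, h])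
  exact not_adj_five h5 (hyb 0) (hyb 1) (hyb 2) (hyb 3) (hbb _ _ (by decide))
    (hbb _ _ (by decide)) (hbb _ _ (by decide)) (hbb _ _ (by decide)) (hbb _ _ (by decide))
    (hbb _ _ (by decide))

open Classical in
/-- A claw-free `6`-double-critical graph without `K₅` has minimum degree at least eight. -/
theorem eight_le_degree (hdc : DoubleCritical G 6) (hcf : ClawFree G) [Fintype V]
    (h5 : ∀ s : Finset V, G.IsClique (s : Set V) → s.card ≠ 5) (x : V) : 8 ≤ G.degree x := by
  by_contra! hdeg
  have hcard : ∀ z, G.Adj x z → #{w | G.Adj x w ∧ w ≠ z ∧ ¬ G.Adj z w} ≤ 2 := fun z hz => by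
    have h1 := hdc.four_le_card_common hz
    have h2 := degree_eq_card_common_add hz
    omega
  obtain ⟨y, a₁, hxy, hxa₁, ha₁y, hya₁⟩ :
      ∃ y a, G.Adj x y ∧ G.Adj x a ∧ a ≠ y ∧ ¬ G.Adj y a := by
    by_contra! hno
    obtain ⟨w, hw⟩ := hdc.exists_adj x
    have h1 := hdc.four_le_card_common hw
    have h2 := degree_eq_card_common_add hw
    obtain ⟨s, hs, hs5⟩ := exists_subset_card_eq (s := G.neighborFinset x) (n := 5)
      (by rw [card_neighborFinset_eq_degree]; omega)
    refine h5 s (fun u hu v hv huv => ?_) hs5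
    exact hno u v (by simpa using hs hu) (by simpa using hs hv) huv.symm
  obtain ⟨a₂, hne, hxa₂, ha₂y, hya₂⟩ := hdc.exists_second_private hxy hxa₁ ha₁y hya₁
  obtain ⟨f, hf⟩ := hdc.exists_coloring hxy
  choose c hxc hyc hfc using hdc.exists_common hf
  refine hdc.false_of_two_private hcf h5 hf hxy hne.symm hxa₁ hxa₂ ha₁y ha₂y hya₁ hya₂ ?_
    c hxc hyc hfc ?_
  · intro z p q r hz hp hpz hzp hq hqz hzq hr hrz hzr
    by_contra! h
    have h3 : #{p, q, r} ≤ #{w | G.Adj x w ∧ w ≠ z ∧ ¬ G.Adj z w} := by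
      refine card_le_card ?_
      simp [insert_subset_iff, *]
    rw [card_eq_three.2 ⟨p, q, r, h.1, h.2.1, h.2.2, rfl⟩] at h3
    have := hcard z hz
    omega
  · have hinj : Function.Injective c := fun i j h => by rw [← hfc i, ← hfc j, h]
    have h4 : (univ.image c).card = 4 := by simp [card_image_of_injective _ hinj]
    have h2 : 2 ≤ #{w | G.Adj x w ∧ w ≠ y ∧ ¬ G.Adj y w} := by
      rw [← card_pair hne]
      refine card_le_card ?_
      simp [insert_subset_iff, *]
    have h1 := degree_eq_card_common_add hxy
    have heq : univ.image c = ({w | G.Adj x w ∧ G.Adj y w} : Finset V) := by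
      refine eq_of_subset_of_card_le (fun w hw => ?_) (by omega)
      obtain ⟨i, -, rfl⟩ := mem_image.1 hw
      simp [hxc, hyc]
    intro w hxw hyw
    have hw : w ∈ univ.image c := by rw [heq]; simp [hxw, hyw]
    obtain ⟨i, -, hi⟩ := mem_image.1 hw
    exact ⟨i, hi.symm⟩

open Classical in
/-- In a claw-free graph of minimum degree at least eight, an independent set contains at most
a fifth of the vertices. -/
theorem _root_.ClawFree.five_mul_card_le (hcf : ClawFree G) [Fintype V]
    (h8 : ∀ v, 8 ≤ G.degree v) {s : Finset V} (hs : ∀ u ∈ s, ∀ v ∈ s, ¬ G.Adj u v) :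
    5 * s.card ≤ Fintype.card V := by
  have h := card_mul_le_card_mul G.Adj (s := s) (t := sᶜ) (m := 8) (n := 2) ?_ ?_
  · have := s.card_compl
    have := s.card_le_univ
    omega
  · intro a ha
    refine (h8 a).trans ?_
    rw [← card_neighborFinset_eq_degree]
    refine card_le_card fun w hw => ?_
    have hw' : G.Adj a w := by simpa using hw
    simp only [mem_bipartiteAbove, mem_compl]
    exact ⟨fun h => hs a ha w h hw', hw'⟩
  · intro v _
    by_contra! h
    obtain ⟨a, b, c, ha, hb, hc, hab, hac, hbc⟩ := two_lt_card_iff.1 h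
    simp only [mem_bipartiteBelow] at ha hb hc
    exact hcf v a b c ha.2.symm hb.2.symm hc.2.symm hab hac hbc (hs a ha.1 b hb.1)
      (hs a ha.1 c hc.1) (hs b hb.1 c hc.1)

open Classical in
theorem card_le_ten (hdc : DoubleCritical G 6) (hcf : ClawFree G) [Fintype V]
    (h8 : ∀ v, 8 ≤ G.degree v) : Fintype.card V ≤ 10 := by
  obtain ⟨x⟩ := hdc.1.nonempty
  obtain ⟨y, hxy⟩ := hdc.exists_adj x
  obtain ⟨f, hf⟩ := hdc.exists_coloring hxy
  have hclass : ∀ i, 5 * #{v ∈ ({x, y}ᶜ : Finset V) | f v = i} ≤ Fintype.card V := by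
    intro i
    refine hcf.five_mul_card_le h8 fun u hu v hv huv => ?_
    simp only [mem_filter, mem_compl, mem_insert, mem_singleton, not_or] at hu hv
    exact hf u v hu.1.1 hu.1.2 hv.1.1 hv.1.2 huv (hu.2.trans hv.2.symm)
  have hsum := card_eq_sum_card_fiberwise (f := f) (s := ({x, y}ᶜ : Finset V))
    (t := (univ : Finset (Fin 4))) (by simp)
  rw [card_compl, card_pair hxy.ne, Fin.sum_univ_four] at hsum
  have h0 := hclass 0
  have h1 := hclass 1
  have h2 := hclass 2
  have h3 := hclass 3
  omega

open Classical in
/-- A graph on at most ten vertices with minimum degree at least eight contains `K₅`. -/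
theorem _root_.SimpleGraph.exists_clique_five [Fintype V] [Nonempty V] (h8 : ∀ v, 8 ≤ G.degree v)
    (h10 : Fintype.card V ≤ 10) : ∃ s : Finset V, G.IsClique (s : Set V) ∧ s.card = 5 := by
  have h9 : 8 < Fintype.card V :=
    (h8 (Classical.arbitrary V)).trans_lt (G.degree_lt_card_verts _)
  have hind : ∀ m ≤ 5, ∃ s : Finset V, G.IsClique (s : Set V) ∧ s.card = m := by
    intro m
    induction m with
    | zero => exact fun _ => ⟨∅, by simp⟩
    | succ m ih =>
      intro hm
      obtain ⟨s, hs, hsm⟩ := ih (by omega)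
      have hle : #(s.biUnion fun v => (G.neighborFinset v)ᶜ) ≤ s.card * 2 :=
        card_biUnion_le_card_mul _ _ _ fun v _ => by
          have := h8 v
          rw [card_compl, card_neighborFinset_eq_degree]
          omega
      obtain ⟨v, hv⟩ : ∃ v, v ∉ s.biUnion fun v => (G.neighborFinset v)ᶜ := by
        by_contra! h
        have := card_le_card fun v (_ : v ∈ univ) => h v
        rw [card_univ] at this
        omega
      have hv' : ∀ u ∈ s, G.Adj u v := by simpa using hv
      refine ⟨insert v s, ?_, ?_⟩
      · rw [coe_insert]
        exact hs.insert fun u hu _ => (hv' u hu).symm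
      · rw [card_insert_of_notMem fun h => (hv' v h).ne rfl, hsm]
  exact hind 5 le_rfl

end DoubleCritical

/-- If a claw-free 6-double-critical graph has an edge whose endpoints have
exactly 4 common neighbors, then it is isomorphic to $K_6$. -/
theorem stmt_8 {V : Type*} [Fintype V] (G : SimpleGraph V)
    (hdc : DoubleCritical G 6) (hcf : ClawFree G)
    (h : ∃ x y : V, G.Adj x y ∧ (G.neighborSet x ∩ G.neighborSet y).ncard = 4) :
    Nonempty (G ≃g (⊤ : SimpleGraph (Fin 6))) := by
  classical
  obtain ⟨s, hs, h5⟩ : ∃ s : Finset V, G.IsClique (s : Set V) ∧ s.card = 5 := by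
    by_contra! hno
    have h8 := fun v => hdc.eight_le_degree hcf hno v
    have := hdc.1.nonempty
    obtain ⟨s, hs, h5⟩ := exists_clique_five h8 (hdc.card_le_ten hcf h8)
    exact hno s hs h5
  exact hdc.nonempty_iso_of_clique_five hs h5
end

section
/- Let $G$ be a $6$-double-critical graph that is claw-free, and let $xy \in E(G)$ with $|N(x) \cap N(y)| = 4$. Then either $G$ is isomorphic to $K_6$, or the degrees of $x$ and $y$ both lie in $\{7, 8\}$. -/
open SimpleGraph

/-- Deleting the ends of an edge leaves a graph coloured by four colours; the colouring is
extended arbitrarily to the two deleted vertices. -/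
lemma DoubleCritical.exists_coloring_s10 {V : Type*} {G : SimpleGraph V} (hdc : DoubleCritical G 6)
    {x y : V} (hxy : G.Adj x y) :
    ∃ c : V → Fin 4, ∀ a b, a ≠ x → a ≠ y → b ≠ x → b ≠ y → G.Adj a b → c a ≠ c b := by
  classical
  have hcol : (G.induce ({x, y}ᶜ : Set V)).Colorable 4 := by
    rw [← chromaticNumber_le_iff_colorable, hdc.2.2 x y hxy]
  obtain ⟨C⟩ := hcol
  refine ⟨fun a => if h : a ∈ ({x, y}ᶜ : Set V) then C ⟨a, h⟩ else 0, ?_⟩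
  intro a b hax hay hbx hby hab
  have ha : a ∈ ({x, y}ᶜ : Set V) := by simp [hax, hay]
  have hb : b ∈ ({x, y}ᶜ : Set V) := by simp [hbx, hby]
  simp only [dif_pos ha, dif_pos hb]
  exact C.valid (v := ⟨a, ha⟩) (w := ⟨b, hb⟩) hab

lemma DoubleCritical.not_colorable_five_s10 {V : Type*} {G : SimpleGraph V}
    (hdc : DoubleCritical G 6) : ¬ G.Colorable 5 := by
  rw [← chromaticNumber_le_iff_colorable, hdc.2.1]
  norm_num

/-- In any 4-colouring of `G - x - y`, every colour occurs on a common neighbour of `x` and `y`. -/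
lemma DoubleCritical.exists_common_neighbor_of_color {V : Type*} {G : SimpleGraph V}
    (hdc : DoubleCritical G 6) {x y : V} (hxy : G.Adj x y) {c : V → Fin 4}
    (hc : ∀ a b, a ≠ x → a ≠ y → b ≠ x → b ≠ y → G.Adj a b → c a ≠ c b) (i : Fin 4) :
    ∃ w, G.Adj x w ∧ G.Adj y w ∧ c w = i := by
  classical
  by_contra! h
  refine hdc.not_colorable_five_s10 ⟨Coloring.mk (fun a => if a = x then i.castSucc
    else if a = y then Fin.last 4
    else if c a = i ∧ G.Adj x a then Fin.last 4 else (c a).castSucc) ?_⟩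
  intro a b hab
  have hcab := hc a b
  have hba := hab.symm
  have hne := hab.ne
  have hyx := hxy.symm
  have hlast : ∀ j : Fin 4, j.castSucc ≠ Fin.last 4 := fun j => (Fin.castSucc_lt_last j).ne
  have hinj : ∀ j k : Fin 4, j.castSucc = k.castSucc → j = k :=
    fun j k => Fin.castSucc_inj.mp
  have hxne := hxy.ne
  split_ifs <;> grind

lemma DoubleCritical.four_le_card_common_neighbors {V : Type*} [Fintype V] [DecidableEq V]
    {G : SimpleGraph V} [DecidableRel G.Adj] (hdc : DoubleCritical G 6) {x y : V}
    (hxy : G.Adj x y) : 4 ≤ (G.neighborFinset x ∩ G.neighborFinset y).card := by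
  obtain ⟨c, hc⟩ := hdc.exists_coloring_s10 hxy
  choose f hx hy hf using hdc.exists_common_neighbor_of_color hxy hc
  have hinj : Function.Injective f := Function.LeftInverse.injective hf
  calc 4 = (Finset.univ.image f).card := by simp [Finset.card_image_of_injective _ hinj]
    _ ≤ _ := Finset.card_le_card fun a ha => by
      obtain ⟨i, -, rfl⟩ := Finset.mem_image.mp ha
      simp [hx, hy]

lemma DoubleCritical.card_clique_sdiff_edge_le {V : Type*} [DecidableEq V]
    {G : SimpleGraph V} (hdc : DoubleCritical G 6) {s : Finset V} (hs : G.IsClique s)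
    {x y : V} (hxy : G.Adj x y) : (s \ {x, y}).card ≤ 4 := by
  obtain ⟨c, hc⟩ := hdc.exists_coloring_s10 hxy
  have hinj : Set.InjOn c (s \ {x, y} : Finset V) := by
    intro a ha b hb hab
    simp only [Finset.coe_sdiff, Set.mem_sdiff, Finset.mem_coe, Finset.mem_insert,
      Finset.mem_singleton, not_or] at ha hb
    by_contra hne
    exact hc a b ha.2.1 ha.2.2 hb.2.1 hb.2.2 (hs ha.1 hb.1 hne) hab
  simpa using Finset.card_le_card_of_injOn c (fun _ _ => Finset.mem_univ _) hinj

lemma DoubleCritical.exists_adj_s10 {V : Type*} {G : SimpleGraph V} (hdc : DoubleCritical G 6)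
    (v : V) : ∃ w, G.Adj v w := by
  have : Nontrivial V := by
    by_contra h
    rw [not_nontrivial_iff_subsingleton] at h
    exact hdc.not_colorable_five_s10
      ⟨Coloring.mk (fun _ => 0) fun {a b} hab => (hab.ne (Subsingleton.elim a b)).elim⟩
  exact hdc.1.preconnected.exists_adj_of_nontrivial v

/-- A 6-double-critical graph with a clique on at least six vertices is `K_6`. -/
lemma DoubleCritical.nonempty_iso_top_of_isClique {V : Type*} [Fintype V] {G : SimpleGraph V}
    (hdc : DoubleCritical G 6) {t : Finset V} (ht : G.IsClique t) (hcard : 6 ≤ t.card) :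
    Nonempty (G ≃g (⊤ : SimpleGraph (Fin 6))) := by
  classical
  obtain ⟨s, hst, hs6⟩ := Finset.exists_subset_card_eq hcard
  have hs : G.IsClique s := ht.subset (Finset.coe_subset.mpr hst)
  have hall : ∀ v, v ∈ s := by
    intro v
    by_contra hv
    obtain ⟨w, hvw⟩ := hdc.exists_adj_s10 v
    have h1 := hdc.card_clique_sdiff_edge_le hs hvw
    have h2 : s \ {v, w} = s.erase w := by grind
    have h3 := Finset.pred_card_le_card_erase (s := s) (a := w)
    rw [h2] at h1
    omega
  have hV : Fintype.card V = 6 := by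
    rw [← hs6, ← Finset.card_univ, (Finset.eq_univ_iff_forall.mpr hall)]
  obtain rfl : G = ⊤ := by
    ext a b
    exact ⟨fun h => h.ne, fun h => hs (hall a) (hall b) h⟩
  exact ⟨Iso.completeGraph (Fintype.equivFinOfCardEq hV)⟩

/-- The minimum degree of a 6-double-critical graph other than `K_6` is at least 7. -/
lemma DoubleCritical.seven_le_degree {V : Type*} [Fintype V] {G : SimpleGraph V}
    [DecidableRel G.Adj] (hdc : DoubleCritical G 6)
    (hK : ¬ Nonempty (G ≃g (⊤ : SimpleGraph (Fin 6)))) (v : V) : 7 ≤ G.degree v := by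
  classical
  by_contra! hlt
  refine hK ?_
  by_cases hcl : G.IsClique (G.neighborFinset v : Set V)
  · have hins : G.IsClique (insert v (G.neighborFinset v) : Finset V) := by
      rw [Finset.coe_insert]
      exact hcl.insert fun b hb _ => by simpa using hb
    refine hdc.nonempty_iso_top_of_isClique hins ?_
    rw [Finset.card_insert_of_notMem (by simp)]
    obtain ⟨w, hvw⟩ := hdc.exists_adj_s10 v
    have h4 := hdc.four_le_card_common_neighbors hvw
    have hw : w ∈ G.neighborFinset v := by simpa using hvw
    have hsub : G.neighborFinset v ∩ G.neighborFinset w ⊆ (G.neighborFinset v).erase w := by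
      intro a ha
      simp only [Finset.mem_inter, mem_neighborFinset] at ha
      simp [ha.1, ha.2.ne']
    have := Finset.card_le_card hsub
    rw [Finset.card_erase_of_mem hw] at this
    omega
  · exfalso
    simp only [SimpleGraph.IsClique, Set.Pairwise, not_forall] at hcl
    obtain ⟨a, ha, b, hb, hne, hab⟩ := hcl
    simp only [Finset.mem_coe, mem_neighborFinset] at ha hb
    obtain ⟨c, hc⟩ := hdc.exists_coloring_s10 ha
    obtain ⟨w, hvw, haw, hcw⟩ := hdc.exists_common_neighbor_of_color ha hc (c b)
    have hba : ¬ G.Adj b a := fun h => hab h.symm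
    have hsub : G.neighborFinset v ∩ G.neighborFinset b
        ⊆ ((G.neighborFinset v).erase a).erase b := by
      intro u hu
      simp only [Finset.mem_inter, mem_neighborFinset] at hu
      simp only [Finset.mem_erase, mem_neighborFinset]
      exact ⟨hu.2.ne', fun h => hba (h ▸ hu.2), hu.1⟩
    have heq := Finset.eq_of_subset_of_card_le hsub (by
      have h4 := hdc.four_le_card_common_neighbors hb
      rw [Finset.card_erase_of_mem (by simp [hne.symm, hb]),
        Finset.card_erase_of_mem (by simp [ha]), card_neighborFinset_eq_degree]
      omega)
    have hwb : w ≠ b := fun h => hab (h ▸ haw)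
    have hmem : w ∈ G.neighborFinset v ∩ G.neighborFinset b := by
      rw [heq]
      simp [hwb, hvw, haw.ne']
    simp only [Finset.mem_inter, mem_neighborFinset] at hmem
    exact hc b w hb.ne' hne.symm hvw.ne' haw.ne' hmem.2 hcw.symm

/-- The neighbours of `x` outside the closed neighbourhood of a neighbour `y` number
`d(x) - |N(x) ∩ N(y)| - 1`. -/
lemma SimpleGraph.card_neighborFinset_sdiff_insert {V : Type*} [Fintype V] [DecidableEq V]
    {G : SimpleGraph V} [DecidableRel G.Adj] {x y : V} (hxy : G.Adj x y) :
    (G.neighborFinset x \ insert y (G.neighborFinset y)).card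
      + (G.neighborFinset x ∩ G.neighborFinset y).card + 1 = G.degree x := by
  have hy : y ∉ G.neighborFinset x ∩ G.neighborFinset y := by simp
  have h := Finset.card_sdiff_add_card_inter (G.neighborFinset x)
    (insert y (G.neighborFinset y))
  rw [Finset.inter_insert_of_mem (by simpa using hxy), Finset.card_insert_of_notMem hy,
    card_neighborFinset_eq_degree] at h
  omega

lemma DoubleCritical.degree_le_eight {V : Type*} [Fintype V] [DecidableEq V] {G : SimpleGraph V}
    [DecidableRel G.Adj] (hdc : DoubleCritical G 6) (hcf : ClawFree G) {x y : V}
    (hxy : G.Adj x y) (hcard : (G.neighborFinset x ∩ G.neighborFinset y).card = 4)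
    (hy : 6 ≤ G.degree y) : G.degree x ≤ 8 := by
  by_contra! hlt
  have hx := card_neighborFinset_sdiff_insert hxy
  have hy' := card_neighborFinset_sdiff_insert hxy.symm
  rw [Finset.inter_comm] at hy'
  obtain ⟨z, hz⟩ : (G.neighborFinset y \ insert x (G.neighborFinset x)).Nonempty :=
    Finset.card_pos.mp (by omega)
  set P := G.neighborFinset x \ insert y (G.neighborFinset y) with hP
  have hmem : ∀ a ∈ P, G.Adj x a ∧ a ≠ y ∧ ¬ G.Adj y a := by
    intro a ha
    simpa [hP] using ha
  simp only [Finset.mem_sdiff, Finset.mem_insert, mem_neighborFinset, not_or] at hz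
  have hclique : G.IsClique (insert x P : Finset V) := by
    rw [Finset.coe_insert]
    refine IsClique.insert (fun a ha b hb hne => ?_) fun b hb _ => (hmem b hb).1
    obtain ⟨hxa, hay, hya⟩ := hmem a ha
    obtain ⟨hxb, hby, hyb⟩ := hmem b hb
    by_contra hab
    exact hcf x y a b hxy hxa hxb hay.symm hby.symm hne hya hyb hab
  have h4 := hdc.card_clique_sdiff_edge_le hclique hz.1
  have hdisj : insert x P \ {y, z} = insert x P := by
    rw [Finset.sdiff_eq_self_iff_disjoint, Finset.disjoint_left]
    have := hxy.ne
    grind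
  rw [hdisj, Finset.card_insert_of_notMem (by simp [hP])] at h4
  omega

/-- In a claw-free 6-double-critical graph, if adjacent vertices $x, y$ have
exactly 4 common neighbors, then either $G \cong K_6$ or both degrees lie in
$\{7, 8\}$. -/
theorem stmt_10 {V : Type*} [Fintype V] (G : SimpleGraph V) [DecidableRel G.Adj]
    (hdc : DoubleCritical G 6) (hcf : ClawFree G)
    (x y : V) (hxy : G.Adj x y)
    (hcard : (G.neighborSet x ∩ G.neighborSet y).ncard = 4) :
    Nonempty (G ≃g (⊤ : SimpleGraph (Fin 6))) ∨
      ((G.degree x = 7 ∨ G.degree x = 8) ∧ (G.degree y = 7 ∨ G.degree y = 8)) := by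
  classical
  by_cases hK : Nonempty (G ≃g (⊤ : SimpleGraph (Fin 6)))
  · exact Or.inl hK
  have hxy4 : (G.neighborFinset x ∩ G.neighborFinset y).card = 4 := by
    rw [← hcard, ← Set.ncard_coe_finset]
    simp
  have hx := hdc.seven_le_degree hK x
  have hy := hdc.seven_le_degree hK y
  have hx8 := hdc.degree_le_eight hcf hxy hxy4 (by omega)
  have hy8 := hdc.degree_le_eight hcf hxy.symm (by rwa [Finset.inter_comm]) (by omega)
  omega
end

section
/- Let $G$ be a $6$-double-critical graph that is claw-free. Then for every edge $xy \in E(G)$, the degree of $x$ satisfies $5 \le d(x) \le 9$. -/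
open SimpleGraph

/-- In a double-critical graph, deleting adjacent vertices leaves an `(n - 2)`-colorable graph:
such a coloring is given here as a map on all vertices that is proper away from `x` and `y`. -/
theorem DoubleCritical.exists_coloring_compl_pair {V : Type*} {G : SimpleGraph V} {n : ℕ}
    (h : DoubleCritical G (n + 3)) {x y : V} (hxy : G.Adj x y) :
    ∃ f : V → Fin (n + 1), ∀ u v : V, u ≠ x → u ≠ y → v ≠ x → v ≠ y → G.Adj u v → f u ≠ f v := by
  classical
  have hcol : (G.induce ({x, y}ᶜ : Set V)).Colorable (n + 1) :=
    chromaticNumber_le_iff_colorable.mp (h.2.2 x y hxy).le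
  obtain ⟨c⟩ := hcol
  refine ⟨fun v => if hv : v ∈ ({x, y}ᶜ : Set V) then c ⟨v, hv⟩ else 0, ?_⟩
  intro u v hux huy hvx hvy huv
  have hu : u ∈ ({x, y}ᶜ : Set V) := by simp [hux, huy]
  have hv : v ∈ ({x, y}ᶜ : Set V) := by simp [hvx, hvy]
  simp only [dif_pos hu, dif_pos hv]
  exact c.valid (v := ⟨u, hu⟩) (w := ⟨v, hv⟩) huv

/-- An `n`-double-critical graph has minimum degree at least `n - 1`. -/
theorem DoubleCritical.le_degree {V : Type*} [Fintype V] {G : SimpleGraph V} [DecidableRel G.Adj]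
    {n : ℕ} (h : DoubleCritical G (n + 3)) {x y : V} (hxy : G.Adj x y) :
    n + 2 ≤ G.degree x := by
  classical
  by_contra! hlt
  obtain ⟨f, hf⟩ := h.exists_coloring_compl_pair hxy
  have hcard : (((G.neighborFinset x).erase y).image f).card < n + 1 := by
    refine Finset.card_image_le.trans_lt ?_
    rw [Finset.card_erase_of_mem (by simpa using hxy), card_neighborFinset_eq_degree]
    omega
  obtain ⟨k, hk⟩ : ∃ k, k ∉ ((G.neighborFinset x).erase y).image f := by
    by_contra! hall
    rw [Finset.eq_univ_iff_forall.mpr hall, Finset.card_univ, Fintype.card_fin] at hcard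
    exact hcard.false
  have hfree : ∀ v, v ≠ y → G.Adj x v → f v ≠ k := fun v hvy hxv hvk =>
    hk (Finset.mem_image.mpr ⟨v, by simp [hvy, hxv], hvk⟩)
  have hcol : G.Colorable (n + 2) := by
    refine ⟨Coloring.mk (fun v => if v = y then Fin.last (n + 1) else
      if v = x then k.castSucc else (f v).castSucc) ?_⟩
    intro u v huv
    have hne := huv.ne
    have hlast : ∀ i : Fin (n + 1), Fin.last (n + 1) ≠ i.castSucc :=
      fun i => (Fin.castSucc_lt_last i).ne'
    split_ifs with huy hvy hvx hux hvy hvx hvy hvx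
    · exact absurd (huy.trans hvy.symm) hne
    · exact hlast _
    · exact hlast _
    · exact (hlast _).symm
    · exact absurd (hux.trans hvx.symm) hne
    · subst hux
      exact fun e => hfree v hvy huv (Fin.castSucc_injective _ e).symm
    · exact (hlast _).symm
    · subst hvx
      exact fun e => hfree u huy huv.symm (Fin.castSucc_injective _ e)
    · exact fun e => hf u v hux huy hvx hvy huv (Fin.castSucc_injective _ e)
  have hle := chromaticNumber_le_iff_colorable.mpr hcol
  rw [h.2.1, Nat.cast_le] at hle
  omega

/-- In a claw-free double-critical graph, each color class of `G - x - y` meets the neighborhood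
of `x` at most twice. -/
theorem DoubleCritical.degree_le_of_clawFree {V : Type*} [Fintype V] {G : SimpleGraph V}
    [DecidableRel G.Adj] {n : ℕ} (h : DoubleCritical G (n + 3)) (hcf : ClawFree G) {x y : V}
    (hxy : G.Adj x y) : G.degree x ≤ 2 * (n + 1) + 1 := by
  classical
  obtain ⟨f, hf⟩ := h.exists_coloring_compl_pair hxy
  have hcard :
      ((G.neighborFinset x).erase y).card ≤ 2 * (Finset.univ : Finset (Fin (n + 1))).card := by
    refine Finset.card_le_mul_card_image_of_maps_to (f := f) (fun _ _ => Finset.mem_univ _) 2 ?_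
    intro k _
    by_contra! hlt
    obtain ⟨a, b, c, ha, hb, hc, hab, hac, hbc⟩ := Finset.two_lt_card_iff.mp hlt
    simp only [Finset.mem_filter, Finset.mem_erase, mem_neighborFinset] at ha hb hc
    obtain ⟨⟨hay, hxa⟩, hak⟩ := ha
    obtain ⟨⟨hby, hxb⟩, hbk⟩ := hb
    obtain ⟨⟨hcy, hxc⟩, hck⟩ := hc
    exact hcf x a b c hxa hxb hxc hab hac hbc
      (fun e => hf a b hxa.ne' hay hxb.ne' hby e (hak.trans hbk.symm))
      (fun e => hf a c hxa.ne' hay hxc.ne' hcy e (hak.trans hck.symm))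
      (fun e => hf b c hxb.ne' hby hxc.ne' hcy e (hbk.trans hck.symm))
  rw [Finset.card_erase_of_mem (by simpa using hxy), card_neighborFinset_eq_degree,
    Finset.card_univ, Fintype.card_fin] at hcard
  omega

/-- In a claw-free 6-double-critical graph, every vertex incident to an edge
has degree between 5 and 9. -/
theorem stmt_12 {V : Type*} [Fintype V] (G : SimpleGraph V) [DecidableRel G.Adj]
    (hdc : DoubleCritical G 6) (hcf : ClawFree G) :
    ∀ x y : V, G.Adj x y → 5 ≤ G.degree x ∧ G.degree x ≤ 9 := by
  intro x y hxy
  exact ⟨DoubleCritical.le_degree (n := 3) hdc hxy,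
    DoubleCritical.degree_le_of_clawFree (n := 3) hdc hcf hxy⟩
end

section
/- Let $G$ be a $6$-double-critical graph that is claw-free, and let $xy \in E(G)$. If some vertex of the subgraph of $G$ induced by $N(x) \cap N(y)$ has degree at least $3$ in that induced subgraph, then $G$ is isomorphic to $K_6$. Equivalently, if $G \not\cong K_6$, then the maximum degree of $G[N(x) \cap N(y)]$ is at most $2$. -/
open SimpleGraph

/-- In a 6-double-critical graph, every 5-clique meets every edge. -/
theorem DoubleCritical.mem_or_mem_of_isClique {V : Type*} {G : SimpleGraph V}
    (hdc : DoubleCritical G 6) {t : Finset V} (ht : G.IsClique t) (hcard : 5 ≤ t.card)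
    {x y : V} (hxy : G.Adj x y) : x ∈ t ∨ y ∈ t := by
  by_contra! hmem
  have hcol : (G.induce ({x, y}ᶜ : Set V)).Colorable 4 :=
    chromaticNumber_le_iff_colorable.1 (hdc.2.2 x y hxy).le
  have hsub : ∀ v ∈ t, v ∈ ({x, y}ᶜ : Set V) := by
    rintro v hv (rfl | rfl)
    exacts [hmem.1 hv, hmem.2 hv]
  obtain ⟨C⟩ := hcol
  have hinj : Function.Injective fun v : t => C ⟨v, hsub v v.2⟩ := by
    intro a b hab
    by_contra hne
    exact C.valid (v := ⟨a, hsub a a.2⟩) (w := ⟨b, hsub b b.2⟩)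
      (ht a.2 b.2 fun h => hne (Subtype.ext h)) hab
  have := Fintype.card_le_of_injective _ hinj
  simp only [Fintype.card_coe, Fintype.card_fin] at this
  omega

/-- A 6-double-critical graph has no vertex outside a 6-clique. -/
theorem DoubleCritical.mem_of_isNClique_six {V : Type*} {G : SimpleGraph V}
    (hdc : DoubleCritical G 6) {t : Finset V} (ht : G.IsNClique 6 t) (u : V) : u ∈ t := by
  classical
  by_contra hu
  obtain ⟨a, ha⟩ : t.Nonempty := Finset.card_pos.1 (by rw [ht.card_eq]; norm_num)
  have : Nontrivial V := ⟨u, a, fun h => hu (h ▸ ha)⟩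
  obtain ⟨v, huv⟩ := hdc.1.preconnected.exists_adj_of_nontrivial u
  have hcard := Finset.pred_card_le_card_erase (s := t) (a := v)
  rw [ht.card_eq] at hcard
  have := hdc.mem_or_mem_of_isClique (t := t.erase v)
    (ht.isClique.subset (by simp)) hcard huv
  simp [hu] at this

/-- A 6-double-critical graph with a 5-clique contains a 6-clique. -/
theorem DoubleCritical.exists_isNClique_six {V : Type*} {G : SimpleGraph V}
    (hdc : DoubleCritical G 6) {t : Finset V} (ht : G.IsNClique 5 t) :
    ∃ s : Finset V, G.IsNClique 6 s := by
  classical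
  by_contra! hno
  have hnon : ∀ v, ∃ a ∈ t, ¬ G.Adj v a ∧ (v ∈ t → a = v) := by
    intro v
    by_cases hv : v ∈ t
    · exact ⟨v, hv, G.irrefl, fun _ => rfl⟩
    · by_contra! hadj
      exact hno _ (ht.insert fun b hb => by
        by_contra hvb
        exact hv (hadj b hb hvb).1)
  choose f hft hfadj hfix using hnon
  have hcol : G.Colorable 5 := by
    let C : G.Coloring t := Coloring.mk (fun v => ⟨f v, hft v⟩) fun {v w} hvw heq => by
      have heq : f v = f w := congrArg Subtype.val heq
      rcases hdc.mem_or_mem_of_isClique ht.isClique ht.card_eq.ge hvw with hv | hw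
      · exact hfadj w (heq ▸ (hfix v hv).symm ▸ hvw.symm)
      · exact hfadj v (heq.symm ▸ (hfix w hw).symm ▸ hvw)
    simpa [ht.card_eq] using C.colorable
  have hle := hcol.chromaticNumber_le
  rw [hdc.2.1] at hle
  exact absurd hle (by norm_num)

/-- The complete graph is the only 6-double-critical graph with a 5-clique. -/
theorem DoubleCritical.nonempty_iso_top_of_isNClique_five {V : Type*} {G : SimpleGraph V}
    (hdc : DoubleCritical G 6) {t : Finset V} (ht : G.IsNClique 5 t) :
    Nonempty (G ≃g (⊤ : SimpleGraph (Fin 6))) := by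
  obtain ⟨s, hs⟩ := hdc.exists_isNClique_six ht
  have hmem := hdc.mem_of_isNClique_six hs
  let e : V ≃ Fin 6 := (Equiv.subtypeUnivEquiv hmem).symm.trans (s.equivFinOfCardEq hs.card_eq)
  refine ⟨⟨e, fun {a b} => ?_⟩⟩
  rw [top_adj, e.injective.ne_iff]
  exact ⟨fun hab => hs.isClique (hmem a) (hmem b) hab, fun hab => hab.ne⟩

/-- In a claw-free 6-double-critical graph, if some vertex of the subgraph
induced by $N(x) \cap N(y)$ (for an edge $xy$) has degree at least 3 there,
then $G \cong K_6$. -/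
theorem stmt_13 {V : Type*} [Fintype V] (G : SimpleGraph V)
    (hdc : DoubleCritical G 6) (hcf : ClawFree G)
    (x y : V) (hxy : G.Adj x y)
    (h : ∃ v : (G.neighborSet x ∩ G.neighborSet y : Set V),
      3 ≤ ((G.induce (G.neighborSet x ∩ G.neighborSet y)).neighborSet v).ncard) :
    Nonempty (G ≃g (⊤ : SimpleGraph (Fin 6))) := by
  classical
  obtain ⟨⟨z, hxz, hyz⟩, hz⟩ := h
  obtain ⟨⟨a, hxa, hya⟩, ⟨b, hxb, hyb⟩, ⟨c, hxc, hyc⟩, hza, hzb, hzc, hab, hac, hbc⟩ :=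
    (Set.two_lt_ncard_iff (Set.toFinite _)).1 hz
  simp only [mem_neighborSet, comap_adj, Function.Embedding.subtype_apply]
    at hxz hyz hxa hya hxb hyb hxc hyc hza hzb hzc
  have key : ∀ p q, G.Adj x p → G.Adj y p → G.Adj z p → G.Adj x q → G.Adj y q → G.Adj z q →
      G.Adj p q → Nonempty (G ≃g (⊤ : SimpleGraph (Fin 6))) := by
    intro p q hxp hyp hzp hxq hyq hzq hpq
    have h3 : G.IsNClique 3 {z, p, q} := is3Clique_triple_iff.2 ⟨hzp, hzq, hpq⟩
    have h4 : G.IsNClique 4 {y, z, p, q} := h3.insert (by simp [hyz, hyp, hyq])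
    have h5 : G.IsNClique 5 {x, y, z, p, q} := h4.insert (by simp [hxy, hxz, hxp, hxq])
    exact hdc.nonempty_iso_top_of_isNClique_five h5
  by_contra hiso
  exact hcf x a b c hxa hxb hxc
    (fun h => hab (Subtype.ext h)) (fun h => hac (Subtype.ext h)) (fun h => hbc (Subtype.ext h))
    (fun h => hiso (key a b hxa hya hza hxb hyb hzb h))
    (fun h => hiso (key a c hxa hya hza hxc hyc hzc h))
    (fun h => hiso (key b c hxb hyb hzb hxc hyc hzc h))
end
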